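/- arXiv:1809.08571 — 4 statements merged into one kernel-verified Lean document; each statement's English description precedes it below -/
import Mathlib

section
/- Let L̂ : ℤ → ℂ satisfy L̂(−k) = conj(L̂(k)) for all k, let Z = {k ∈ ℤ : L̂(k) = 0} be finite, and assume Σ_{k ∉ Z} |L̂(k)|^{-2} < ∞. Fix γ > 0 and define w : ℤ → ℝ by w(k) = |L̂(k)|² for k ∉ Z and w(k) = γ² for k ∈ Z. Let H_w be the Hilbert space of sequences c : ℤ → ℂ with Σ_k w(k)|c(k)|² < ∞. Let t_1, …, t_M ∈ [0,1), let y ∈ ℂ^M, λ > 0, and for c ∈ H_w set ν_m(c) = Σ_{k∈ℤ} c(k) e^{2πi k t_m} (this series converges absolutely). Assume that the only sequence supported on Z annihilated by all ν_m is 0. Then the minimization problem min_{c ∈ H_w} Σ_{m=1}^M |y_m − ν_m(c)|² + λ Σ_{k ∉ Z} |L̂(k)|² |c(k)|² has a unique solution c*, and there exists a ∈ ℂ^M such that for every k ∈ ℤ, |L̂(k)|² c*(k) = Σ_{m=1}^M a_m e^{−2πi k t_m}. -/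
open Complex

/-- The measurement functional: `ν_m(c) = Σ_k c(k) e^{2πi k t_m}`. -/
noncomputable def sampMeas (t : ℝ) (c : ℤ → ℂ) : ℂ :=
  ∑' k : ℤ, c k * Complex.exp (2 * Real.pi * Complex.I * (k : ℂ) * (t : ℂ))

theorem norm_exp_two_pi_I_mul_int_mul_real (k : ℤ) (t : ℝ) :
    ‖Complex.exp (2 * Real.pi * Complex.I * (k : ℂ) * (t : ℂ))‖ = 1 := by
  rw [show (2 * Real.pi * Complex.I * (k : ℂ) * (t : ℂ) : ℂ)
    = ((2 * Real.pi * k * t : ℝ) : ℂ) * Complex.I by push_cast; ring]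
  exact Complex.norm_exp_ofReal_mul_I _

theorem conj_exp_neg_two_pi_I_mul_int_mul_real (k : ℤ) (t : ℝ) :
    starRingEnd ℂ (Complex.exp (-(2 * Real.pi * Complex.I * (k : ℂ) * (t : ℂ)))) =
      Complex.exp (2 * Real.pi * Complex.I * (k : ℂ) * (t : ℂ)) := by
  rw [← Complex.exp_conj]
  simp [Complex.conj_ofNat]

theorem norm_exp_neg_two_pi_I_mul_int_mul_real (k : ℤ) (t : ℝ) :
    ‖Complex.exp (-(2 * Real.pi * Complex.I * (k : ℂ) * (t : ℂ)))‖ = 1 := by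
  rw [← RCLike.norm_conj, conj_exp_neg_two_pi_I_mul_int_mul_real,
    norm_exp_two_pi_I_mul_int_mul_real]

/-- The trigonometric sum `Σ_m a_m e^{−2πi k t_m}`, linear in the coefficients `a`. -/
noncomputable def expSum {M : ℕ} (t : Fin M → ℝ) (k : ℤ) : (Fin M → ℂ) →ₗ[ℂ] ℂ where
  toFun a := ∑ m, a m * Complex.exp (-(2 * Real.pi * Complex.I * (k : ℂ) * (t m : ℂ)))
  map_add' a b := by simp [add_mul, Finset.sum_add_distrib]
  map_smul' r a := by simp [Finset.mul_sum, mul_assoc]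

theorem expSum_apply {M : ℕ} (t : Fin M → ℝ) (k : ℤ) (a : Fin M → ℂ) :
    expSum t k a =
      ∑ m, a m * Complex.exp (-(2 * Real.pi * Complex.I * (k : ℂ) * (t m : ℂ))) :=
  rfl

theorem norm_expSum_le {M : ℕ} (t : Fin M → ℝ) (k : ℤ) (a : Fin M → ℂ) :
    ‖expSum t k a‖ ≤ ∑ m, ‖a m‖ := by
  rw [expSum_apply]
  refine (norm_sum_le _ _).trans_eq (Finset.sum_congr rfl fun m _ => ?_)
  rw [norm_mul, norm_exp_neg_two_pi_I_mul_int_mul_real, mul_one]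

section Measurement

theorem summable_norm_mul_exp {c : ℤ → ℂ} (hc : Summable fun k => ‖c k‖) (t : ℝ) :
    Summable fun k : ℤ =>
      ‖c k * Complex.exp (2 * Real.pi * Complex.I * (k : ℂ) * (t : ℂ))‖ := by
  simpa only [norm_mul, norm_exp_two_pi_I_mul_int_mul_real, mul_one] using hc

theorem hasSum_sampMeas {c : ℤ → ℂ} (hc : Summable fun k => ‖c k‖) (t : ℝ) :
    HasSum (fun k : ℤ => c k * Complex.exp (2 * Real.pi * Complex.I * (k : ℂ) * (t : ℂ)))
      (sampMeas t c) :=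
  (summable_norm_mul_exp hc t).of_norm.hasSum

theorem sampMeas_add {c d : ℤ → ℂ} (hc : Summable fun k => ‖c k‖)
    (hd : Summable fun k => ‖d k‖) (t : ℝ) :
    sampMeas t (c + d) = sampMeas t c + sampMeas t d := by
  rw [← ((hasSum_sampMeas hc t).add (hasSum_sampMeas hd t)).tsum_eq]
  simp only [sampMeas, Pi.add_apply, add_mul]

theorem sampMeas_smul (r : ℂ) (c : ℤ → ℂ) (t : ℝ) :
    sampMeas t (r • c) = r * sampMeas t c := by
  simp only [sampMeas, Pi.smul_apply, smul_eq_mul, mul_assoc, tsum_mul_left]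

/-- Pairing a trigonometric sum with an absolutely summable sequence. -/
theorem hasSum_conj_expSum_mul {M : ℕ} (t : Fin M → ℝ) (a : Fin M → ℂ) {h : ℤ → ℂ}
    (hh : Summable fun k => ‖h k‖) :
    HasSum (fun k => starRingEnd ℂ (expSum t k a) * h k)
      (∑ m, starRingEnd ℂ (a m) * sampMeas (t m) h) := by
  have hs := hasSum_sum fun m (_ : m ∈ Finset.univ) =>
    (hasSum_sampMeas hh (t m)).mul_left (starRingEnd ℂ (a m))
  refine hs.congr_fun fun k => ?_
  rw [expSum_apply, map_sum, Finset.sum_mul]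
  refine Finset.sum_congr rfl fun m _ => ?_
  rw [map_mul, conj_exp_neg_two_pi_I_mul_int_mul_real]
  ring

end Measurement

section Weight

variable {Lhat : ℤ → ℂ} {γ : ℝ} {w : ℤ → ℝ}

theorem weight_pos (hγ : 0 < γ)
    (hw : ∀ k, w k = if Lhat k = 0 then γ ^ 2 else ‖Lhat k‖ ^ 2) (k : ℤ) : 0 < w k := by
  rw [hw]
  split_ifs with h <;> positivity

theorem normSq_le_weight (hw : ∀ k, w k = if Lhat k = 0 then γ ^ 2 else ‖Lhat k‖ ^ 2)
    (k : ℤ) : ‖Lhat k‖ ^ 2 ≤ w k := by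
  rw [hw]
  split_ifs with h
  · simpa [h] using sq_nonneg γ
  · exact le_rfl

theorem summable_energy (hw : ∀ k, w k = if Lhat k = 0 then γ ^ 2 else ‖Lhat k‖ ^ 2)
    {c : ℤ → ℂ} (hc : Summable fun k => w k * ‖c k‖ ^ 2) :
    Summable fun k => ‖Lhat k‖ ^ 2 * ‖c k‖ ^ 2 :=
  hc.of_nonneg_of_le (fun _ => by positivity) fun k =>
    mul_le_mul_of_nonneg_right (normSq_le_weight hw k) (sq_nonneg _)

theorem summable_weight_inv (hZfin : {k : ℤ | Lhat k = 0}.Finite)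
    (hsum : Summable fun k : ℤ => if Lhat k = 0 then (0 : ℝ) else (‖Lhat k‖ ^ 2)⁻¹)
    (hw : ∀ k, w k = if Lhat k = 0 then γ ^ 2 else ‖Lhat k‖ ^ 2) :
    Summable fun k => (w k)⁻¹ := by
  refine hsum.congr_cofinite ?_
  filter_upwards [hZfin.compl_mem_cofinite] with k hk
  have hk' : Lhat k ≠ 0 := hk
  simp [hw, hk']

theorem summable_norm_of_weighted (hpos : ∀ k, 0 < w k)
    (hinv : Summable fun k => (w k)⁻¹) {c : ℤ → ℂ}
    (hc : Summable fun k => w k * ‖c k‖ ^ 2) : Summable fun k => ‖c k‖ := by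
  refine (hinv.add hc).of_nonneg_of_le (fun _ => norm_nonneg _) fun k => ?_
  have hk := hpos k
  have h1 : (w k)⁻¹ * w k = 1 := inv_mul_cancel₀ hk.ne'
  have h2 : 0 ≤ (w k)⁻¹ * (w k * ‖c k‖ - 1) ^ 2 := by positivity
  have h3 : (w k)⁻¹ * (w k * ‖c k‖ - 1) ^ 2 = w k * ‖c k‖ ^ 2 - 2 * ‖c k‖ + (w k)⁻¹ := by
    linear_combination (w k * ‖c k‖ ^ 2 - 2 * ‖c k‖) * h1
  linarith [norm_nonneg (c k)]

theorem summable_weighted_sub (hpos : ∀ k, 0 < w k) {c d : ℤ → ℂ}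
    (hc : Summable fun k => w k * ‖c k‖ ^ 2) (hd : Summable fun k => w k * ‖d k‖ ^ 2) :
    Summable fun k => w k * ‖(c - d) k‖ ^ 2 := by
  refine ((hc.add hd).mul_left 2).of_nonneg_of_le
    (fun k => mul_nonneg (hpos k).le (sq_nonneg _)) fun k => ?_
  have h1 : ‖(c - d) k‖ ^ 2 ≤ (‖c k‖ + ‖d k‖) ^ 2 :=
    pow_le_pow_left₀ (norm_nonneg _) (norm_sub_le _ _) 2
  have h2 : ‖(c - d) k‖ ^ 2 ≤ 2 * (‖c k‖ ^ 2 + ‖d k‖ ^ 2) := by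
    nlinarith [sq_nonneg (‖c k‖ - ‖d k‖)]
  nlinarith [mul_le_mul_of_nonneg_left h2 (hpos k).le]

end Weight

section Spline

variable {Lhat : ℤ → ℂ} {M : ℕ} {t : Fin M → ℝ}

/-- The sequence equal to `p` on the zero set of `Lhat` and to
`|Lhat k|⁻² Σ_m a_m e^{−2πi k t_m}` off it, linear in `(p, a)`. -/
noncomputable def splineSeq (Lhat : ℤ → ℂ) {M : ℕ} (t : Fin M → ℝ) :
    (({k : ℤ | Lhat k = 0} → ℂ) × (Fin M → ℂ)) →ₗ[ℂ] (ℤ → ℂ) := by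
  classical
  exact LinearMap.pi fun k =>
    if h : Lhat k = 0 then LinearMap.proj ⟨k, h⟩ ∘ₗ LinearMap.fst ℂ _ _
    else ((‖Lhat k‖ : ℂ) ^ 2)⁻¹ • (expSum t k ∘ₗ LinearMap.snd ℂ _ _)

theorem splineSeq_of_eq_zero (x : ({k : ℤ | Lhat k = 0} → ℂ) × (Fin M → ℂ)) {k : ℤ}
    (h : Lhat k = 0) : splineSeq Lhat t x k = x.1 ⟨k, h⟩ := by
  simp [splineSeq, h]

theorem splineSeq_of_ne_zero (x : ({k : ℤ | Lhat k = 0} → ℂ) × (Fin M → ℂ)) {k : ℤ}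
    (h : Lhat k ≠ 0) :
    splineSeq Lhat t x k = ((‖Lhat k‖ : ℂ) ^ 2)⁻¹ * expSum t k x.2 := by
  simp [splineSeq, h]

theorem normSq_mul_splineSeq (x : ({k : ℤ | Lhat k = 0} → ℂ) × (Fin M → ℂ))
    (hx : ∀ k, Lhat k = 0 → expSum t k x.2 = 0) (k : ℤ) :
    (‖Lhat k‖ : ℂ) ^ 2 * splineSeq Lhat t x k = expSum t k x.2 := by
  by_cases h : Lhat k = 0
  · simp [h, hx k h]
  · have : (‖Lhat k‖ : ℂ) ≠ 0 := by simpa using h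
    rw [splineSeq_of_ne_zero x h, mul_inv_cancel_left₀ (pow_ne_zero 2 this)]

theorem summable_weighted_splineSeq {γ : ℝ} {w : ℤ → ℝ}
    (hZfin : {k : ℤ | Lhat k = 0}.Finite)
    (hsum : Summable fun k : ℤ => if Lhat k = 0 then (0 : ℝ) else (‖Lhat k‖ ^ 2)⁻¹)
    (hw : ∀ k, w k = if Lhat k = 0 then γ ^ 2 else ‖Lhat k‖ ^ 2)
    (x : ({k : ℤ | Lhat k = 0} → ℂ) × (Fin M → ℂ)) :
    Summable fun k => w k * ‖splineSeq Lhat t x k‖ ^ 2 := by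
  refine Summable.of_norm_bounded_eventually (hsum.mul_left ((∑ m, ‖x.2 m‖) ^ 2)) ?_
  filter_upwards [hZfin.compl_mem_cofinite] with k hk
  have hk' : Lhat k ≠ 0 := hk
  have hL : 0 < ‖Lhat k‖ := norm_pos_iff.mpr hk'
  have hE : ‖expSum t k x.2‖ ^ 2 ≤ (∑ m, ‖x.2 m‖) ^ 2 :=
    pow_le_pow_left₀ (norm_nonneg _) (norm_expSum_le t k x.2) 2
  have heq : w k * ‖splineSeq Lhat t x k‖ ^ 2 =
      ‖expSum t k x.2‖ ^ 2 * (‖Lhat k‖ ^ 2)⁻¹ := by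
    rw [hw, if_neg hk', splineSeq_of_ne_zero x hk', norm_mul, norm_inv, norm_pow,
      Complex.norm_real, norm_norm]
    field_simp
  rw [heq, if_neg hk', Real.norm_of_nonneg (by positivity)]
  exact mul_le_mul_of_nonneg_right hE (by positivity)

/-- The linear system behind the Euler–Lagrange equations is solvable. -/
theorem exists_splineSeq_eq (hZfin : {k : ℤ | Lhat k = 0}.Finite)
    (hS : ∀ x, Summable fun k => ‖splineSeq Lhat t x k‖) {lam : ℝ} (hlam : 0 < lam)
    (hinj : ∀ c : ℤ → ℂ, (∀ k, Lhat k ≠ 0 → c k = 0) →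
      (∀ m, sampMeas (t m) c = 0) → c = 0) (y : Fin M → ℂ) :
    ∃ x, (∀ k, Lhat k = 0 → expSum t k x.2 = 0) ∧
      ∀ m, sampMeas (t m) (splineSeq Lhat t x) + lam * x.2 m = y m := by
  have : Finite {k : ℤ | Lhat k = 0} := hZfin
  let T : (({k : ℤ | Lhat k = 0} → ℂ) × (Fin M → ℂ)) →ₗ[ℂ]
      (({k : ℤ | Lhat k = 0} → ℂ) × (Fin M → ℂ)) :=
    { toFun := fun x => (fun k => expSum t k x.2,
        fun m => sampMeas (t m) (splineSeq Lhat t x) + lam * x.2 m)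
      map_add' := fun x x' => by
        ext i
        · simp
        · simp only [map_add, sampMeas_add (hS x) (hS x'), Prod.snd_add, Pi.add_apply]
          ring
      map_smul' := fun r x => by
        ext i
        · simp
        · simp only [map_smul, sampMeas_smul, Prod.smul_snd, Pi.smul_apply, smul_eq_mul,
            RingHom.id_apply]
          ring }
  have hT : Function.Injective T := by
    refine (injective_iff_map_eq_zero T).mpr fun x hx => ?_
    have h1 : ∀ k, Lhat k = 0 → expSum t k x.2 = 0 := fun k hk =>
      congrFun (congrArg Prod.fst hx) ⟨k, hk⟩
    have h2 : ∀ m, sampMeas (t m) (splineSeq Lhat t x) + lam * x.2 m = 0 := fun m =>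
      congrFun (congrArg Prod.snd hx) m
    have hpair := Complex.hasSum_re (hasSum_conj_expSum_mul t x.2 (hS x))
    have hnonneg : 0 ≤ (∑ m, starRingEnd ℂ (x.2 m) *
        sampMeas (t m) (splineSeq Lhat t x)).re := by
      refine hpair.nonneg fun k => ?_
      rw [← normSq_mul_splineSeq x h1 k, map_mul, mul_assoc, ← Complex.normSq_eq_conj_mul_self,
        ← Complex.ofReal_pow, Complex.conj_ofReal, ← Complex.ofReal_mul, Complex.ofReal_re]
      exact mul_nonneg (by positivity) (Complex.normSq_nonneg _)
    have hval : (∑ m, starRingEnd ℂ (x.2 m) * sampMeas (t m) (splineSeq Lhat t x)).re =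
        -(lam * ∑ m, ‖x.2 m‖ ^ 2) := by
      rw [Complex.re_sum, Finset.mul_sum, ← Finset.sum_neg_distrib]
      refine Finset.sum_congr rfl fun m _ => ?_
      rw [eq_neg_of_add_eq_zero_left (h2 m), ← Complex.normSq_eq_norm_sq,
        Complex.normSq_apply]
      simp
      ring
    have hsq : ∑ m, ‖x.2 m‖ ^ 2 = 0 :=
      le_antisymm (by nlinarith) (Finset.sum_nonneg fun _ _ => sq_nonneg _)
    have ha : x.2 = 0 := by
      ext m
      simpa using (Finset.sum_eq_zero_iff_of_nonneg fun _ _ => sq_nonneg _).mp hsq m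
        (Finset.mem_univ m)
    have hc : splineSeq Lhat t x = 0 := by
      refine hinj _ (fun k hk => ?_) fun m => ?_
      · rw [splineSeq_of_ne_zero x hk, ha, map_zero, mul_zero]
      · simpa [ha] using h2 m
    refine Prod.ext (funext fun k => ?_) ha
    rw [← splineSeq_of_eq_zero (t := t) x k.2, hc]
    rfl
  obtain ⟨x, hx⟩ := LinearMap.injective_iff_surjective.mp hT (0, y)
  exact ⟨x, fun k hk => congrFun (congrArg Prod.fst hx) ⟨k, hk⟩,
    fun m => congrFun (congrArg Prod.snd hx) m⟩

end Spline

theorem Complex.norm_add_sq_eq (u v : ℂ) :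
    ‖u + v‖ ^ 2 = ‖u‖ ^ 2 + ‖v‖ ^ 2 + 2 * (starRingEnd ℂ u * v).re := by
  simp only [← Complex.normSq_eq_norm_sq, Complex.normSq_apply]
  simp
  ring

/-- Exact expansion of the variational functional around a solution of the
Euler–Lagrange equations. -/
theorem variational_functional_expand {Lhat : ℤ → ℂ} {M : ℕ} {t : Fin M → ℝ}
    {y a : Fin M → ℂ} {lam : ℝ} {c d : ℤ → ℂ}
    (hc : Summable fun k => ‖c k‖) (hd : Summable fun k => ‖d k‖)
    (hcE : Summable fun k => ‖Lhat k‖ ^ 2 * ‖c k‖ ^ 2)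
    (hdE : Summable fun k => ‖Lhat k‖ ^ 2 * ‖d k‖ ^ 2)
    (hspline : ∀ k, (‖Lhat k‖ : ℂ) ^ 2 * c k = expSum t k a)
    (hres : ∀ m, sampMeas (t m) c + lam * a m = y m) :
    (∑ m, ‖y m - sampMeas (t m) (c + d)‖ ^ 2) +
        lam * ∑' k : ℤ, ‖Lhat k‖ ^ 2 * ‖(c + d) k‖ ^ 2 =
      ((∑ m, ‖y m - sampMeas (t m) c‖ ^ 2) +
        lam * ∑' k : ℤ, ‖Lhat k‖ ^ 2 * ‖c k‖ ^ 2) +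
      ((∑ m, ‖sampMeas (t m) d‖ ^ 2) + lam * ∑' k : ℤ, ‖Lhat k‖ ^ 2 * ‖d k‖ ^ 2) := by
  have hcross := (Complex.hasSum_re (hasSum_conj_expSum_mul t a hd)).mul_left 2
  have hE : ∑' k : ℤ, ‖Lhat k‖ ^ 2 * ‖(c + d) k‖ ^ 2 =
      (∑' k : ℤ, ‖Lhat k‖ ^ 2 * ‖c k‖ ^ 2) + (∑' k : ℤ, ‖Lhat k‖ ^ 2 * ‖d k‖ ^ 2) +
        2 * (∑ m, starRingEnd ℂ (a m) * sampMeas (t m) d).re := by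
    rw [← ((hcE.hasSum.add hdE.hasSum).add hcross).tsum_eq]
    refine tsum_congr fun k => ?_
    rw [Pi.add_apply, Complex.norm_add_sq_eq, ← hspline k, map_mul, ← Complex.ofReal_pow,
      Complex.conj_ofReal, mul_assoc, Complex.re_ofReal_mul]
    ring
  have hD : ∑ m, ‖y m - sampMeas (t m) (c + d)‖ ^ 2 =
      (∑ m, ‖y m - sampMeas (t m) c‖ ^ 2) + (∑ m, ‖sampMeas (t m) d‖ ^ 2) -
        2 * lam * (∑ m, starRingEnd ℂ (a m) * sampMeas (t m) d).re := by
    rw [Complex.re_sum, Finset.mul_sum, ← Finset.sum_add_distrib, ← Finset.sum_sub_distrib]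
    refine Finset.sum_congr rfl fun m _ => ?_
    rw [sampMeas_add hc hd, ← sub_sub, sub_eq_add_neg _ (sampMeas (t m) d),
      Complex.norm_add_sq_eq, norm_neg, ← hres m, add_sub_cancel_left, map_mul,
      Complex.conj_ofReal, mul_assoc, Complex.re_ofReal_mul, mul_neg, Complex.neg_re]
    ring
  rw [hE, hD]
  ring

/-- **Proposition 5: the variational solution for time-domain sampling is a periodic
`(L*L)`-spline.**  Let `L̂ : ℤ → ℂ` be Hermitian-symmetric with finite zero set and
`Σ_{L̂(k)≠0} |L̂(k)|⁻² < ∞`; let `w(k) = |L̂(k)|²` off the zero set and `γ²` on it, and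
let `H_w` be the sequences `c` with `Σ w(k)|c(k)|² < ∞`.  For sampling points
`t_1, …, t_M ∈ [0,1)`, data `y`, and `λ > 0`, the point-evaluation series converge
absolutely on `H_w`, the quadratic variational problem has a unique solution `c*` in
`H_w`, and there is `a ∈ ℂ^M` with `|L̂(k)|² c*(k) = Σ_m a_m e^{−2πi k t_m}` for all
`k ∈ ℤ`. -/
theorem variational_solution_is_periodic_spline
    (Lhat : ℤ → ℂ) (hsym : ∀ k : ℤ, Lhat (-k) = starRingEnd ℂ (Lhat k))
    (hZfin : {k : ℤ | Lhat k = 0}.Finite)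
    (hsum : Summable fun k : ℤ => if Lhat k = 0 then (0 : ℝ) else (‖Lhat k‖ ^ 2)⁻¹)
    (γ : ℝ) (hγ : 0 < γ)
    (w : ℤ → ℝ) (hw : ∀ k, w k = if Lhat k = 0 then γ ^ 2 else ‖Lhat k‖ ^ 2)
    {M : ℕ} (t : Fin M → ℝ) (ht : ∀ m, t m ∈ Set.Ico (0 : ℝ) 1)
    (y : Fin M → ℂ) (lam : ℝ) (hlam : 0 < lam)
    (hinj : ∀ c : ℤ → ℂ, (∀ k, Lhat k ≠ 0 → c k = 0) →
      (∀ m, sampMeas (t m) c = 0) → c = 0) :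
    (∀ c : ℤ → ℂ, Summable (fun k => w k * ‖c k‖ ^ 2) → ∀ m : Fin M,
        Summable fun k : ℤ =>
          ‖c k * Complex.exp (2 * Real.pi * Complex.I * (k : ℂ) * (t m : ℂ))‖) ∧
    ∃ cstar : ℤ → ℂ,
      Summable (fun k => w k * ‖cstar k‖ ^ 2) ∧
      (∀ c : ℤ → ℂ, Summable (fun k => w k * ‖c k‖ ^ 2) →
          (∑ m, ‖y m - sampMeas (t m) cstar‖ ^ 2) +
              lam * ∑' k : ℤ, ‖Lhat k‖ ^ 2 * ‖cstar k‖ ^ 2 ≤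
            (∑ m, ‖y m - sampMeas (t m) c‖ ^ 2) +
              lam * ∑' k : ℤ, ‖Lhat k‖ ^ 2 * ‖c k‖ ^ 2) ∧
      (∀ c : ℤ → ℂ, Summable (fun k => w k * ‖c k‖ ^ 2) →
          (∀ c' : ℤ → ℂ, Summable (fun k => w k * ‖c' k‖ ^ 2) →
              (∑ m, ‖y m - sampMeas (t m) c‖ ^ 2) +
                  lam * ∑' k : ℤ, ‖Lhat k‖ ^ 2 * ‖c k‖ ^ 2 ≤
                (∑ m, ‖y m - sampMeas (t m) c'‖ ^ 2) +
                  lam * ∑' k : ℤ, ‖Lhat k‖ ^ 2 * ‖c' k‖ ^ 2) →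
            c = cstar) ∧
      ∃ a : Fin M → ℂ, ∀ k : ℤ,
        ((‖Lhat k‖ : ℂ) ^ 2) * cstar k =
          ∑ m, a m * Complex.exp (-(2 * Real.pi * Complex.I * (k : ℂ) * (t m : ℂ))) := by
  have hpos := weight_pos hγ hw
  have hinv := summable_weight_inv hZfin hsum hw
  have hnorm : ∀ c : ℤ → ℂ, Summable (fun k => w k * ‖c k‖ ^ 2) →
      Summable fun k => ‖c k‖ := fun c => summable_norm_of_weighted hpos hinv
  have hS := summable_weighted_splineSeq (t := t) hZfin hsum hw
  refine ⟨fun c hc m => summable_norm_mul_exp (hnorm c hc) (t m), ?_⟩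
  obtain ⟨x, hx1, hx2⟩ := exists_splineSeq_eq hZfin (fun x => hnorm _ (hS x)) hlam hinj y
  have hspline := normSq_mul_splineSeq x hx1
  have hexpand : ∀ c : ℤ → ℂ, Summable (fun k => w k * ‖c k‖ ^ 2) → _ := fun c hc =>
    have hd := summable_weighted_sub hpos hc (hS x)
    variational_functional_expand (hnorm _ (hS x)) (hnorm _ hd) (summable_energy hw (hS x))
      (summable_energy hw hd) hspline hx2
  simp only [add_sub_cancel] at hexpand
  have hEnonneg : ∀ d : ℤ → ℂ, 0 ≤ ∑' k : ℤ, ‖Lhat k‖ ^ 2 * ‖d k‖ ^ 2 := fun d =>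
    tsum_nonneg fun k => by positivity
  have hDnonneg : ∀ d : ℤ → ℂ, 0 ≤ ∑ m, ‖sampMeas (t m) d‖ ^ 2 := fun d =>
    Finset.sum_nonneg fun m _ => sq_nonneg _
  refine ⟨splineSeq Lhat t x, hS x, fun c hc => ?_, fun c hc hmin => ?_, x.2, hspline⟩
  · rw [hexpand c hc]
    have := mul_nonneg hlam.le (hEnonneg (c - splineSeq Lhat t x))
    linarith [hDnonneg (c - splineSeq Lhat t x)]
  · have hle := hmin _ (hS x)
    rw [hexpand c hc] at hle
    set d := c - splineSeq Lhat t x with hd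
    have hdE := summable_energy hw (summable_weighted_sub hpos hc (hS x))
    have hlE := mul_nonneg hlam.le (hEnonneg d)
    have hD0 : ∑ m, ‖sampMeas (t m) d‖ ^ 2 = 0 := by linarith [hDnonneg d]
    have hE0 : ∑' k : ℤ, ‖Lhat k‖ ^ 2 * ‖d k‖ ^ 2 = 0 :=
      (mul_eq_zero.mp (by linarith [hDnonneg d])).resolve_left hlam.ne'
    have hterm := (hasSum_zero_iff_of_nonneg fun k => by positivity).mp (hE0 ▸ hdE.hasSum)
    refine sub_eq_zero.mp (hinj d (fun k hk => ?_) fun m => ?_)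
    · have hk0 : ‖Lhat k‖ ^ 2 * ‖d k‖ ^ 2 = 0 := congrFun hterm k
      have hL : ‖Lhat k‖ ^ 2 ≠ 0 := by simpa using hk
      exact norm_eq_zero.mp (pow_eq_zero_iff two_ne_zero |>.mp
        ((mul_eq_zero.mp hk0).resolve_left hL))
    · simpa using (Finset.sum_eq_zero_iff_of_nonneg fun _ _ => sq_nonneg _).mp hD0 m
        (Finset.mem_univ m)
end

section
/- Let V be a finite-dimensional complex subspace of the space of continuous 1-periodic functions f : ℝ → ℂ (i.e., f(t+1) = f(t) for all t) that is invariant under all translations: for every f ∈ V and t₀ ∈ ℝ, the function t ↦ f(t − t₀) belongs to V. Then there exist distinct integers k_1, …, k_{N₀}, with N₀ = dim V, such that V = span{e_{k_1}, …, e_{k_{N₀}}}, where e_k(t) = exp(2πi k t). -/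
open MeasureTheory AddCircle in
/-- A finite-dimensional translation-invariant space of continuous functions on the circle contains
every Fourier monomial for which one of its members has a nonzero Fourier coefficient. -/
theorem fourier_mem_of_fourierCoeff_ne_zero {T : ℝ} [Fact (0 < T)]
    (W : Submodule ℂ C(AddCircle T, ℂ)) [FiniteDimensional ℂ W]
    (hW : ∀ f ∈ W, ∀ a, f.comp (ContinuousMap.id _ - ContinuousMap.const _ a) ∈ W)
    {f : C(AddCircle T, ℂ)} (hf : f ∈ W) {n : ℤ} (hn : fourierCoeff f n ≠ 0) :
    fourier n ∈ W := by
  let F : C(AddCircle T, C(AddCircle T, ℂ)) :=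
    ContinuousMap.curry ⟨fun p => fourier n p.1 * f (p.2 - p.1), by fun_prop⟩
  have hF : ∀ s, F s ∈ W := fun s => by
    have : F s = fourier n s • f.comp (ContinuousMap.id _ - ContinuousMap.const _ s) := by
      ext x; simp [F]
    rw [this]
    exact W.smul_mem _ (hW f hf s)
  have hint : Integrable F haarAddCircle :=
    F.continuous.integrable_of_hasCompactSupport (HasCompactSupport.of_compactSpace _)
  have hmem : ∫ s, F s ∂haarAddCircle ∈ W :=
    (W.restrictScalars ℝ).convex.integral_mem W.closed_of_finiteDimensional
      (Filter.Eventually.of_forall hF) hint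
  have heq : ∫ s, F s ∂haarAddCircle = fourierCoeff f n • fourier n := by
    ext x
    rw [ContinuousMap.integral_apply hint, ContinuousMap.smul_apply, fourierCoeff,
      ← integral_sub_left_eq_self _ _ x, smul_eq_mul, ← integral_mul_const]
    refine integral_congr_ae (Filter.Eventually.of_forall fun s => ?_)
    have : fourier n (x - s) = fourier (-n) s * fourier n x := by
      simp only [fourier_apply, ← Circle.coe_mul, ← toCircle_add]
      congr 2
      rw [neg_smul, smul_sub]
      abel
    simp only [F, ContinuousMap.curry_apply, ContinuousMap.coe_mk, smul_eq_mul, this, sub_sub_cancel]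
    ring
  rw [heq] at hmem
  exact (W.smul_mem_iff hn).1 hmem

theorem linearIndependent_fourier {T : ℝ} [Fact (0 < T)] :
    LinearIndependent ℂ (fourier : ℤ → C(AddCircle T, ℂ)) :=
  LinearIndependent.of_comp
    (ContinuousMap.toLp (E := ℂ) 2 AddCircle.haarAddCircle ℂ).toLinearMap
    orthonormal_fourier.linearIndependent

/-- A finite-dimensional translation-invariant space of continuous functions on the circle is
spanned by finitely many Fourier monomials. -/
theorem exists_finset_eq_span_fourier {T : ℝ} [Fact (0 < T)]
    (W : Submodule ℂ C(AddCircle T, ℂ)) [FiniteDimensional ℂ W]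
    (hW : ∀ f ∈ W, ∀ a, f.comp (ContinuousMap.id _ - ContinuousMap.const _ a) ∈ W) :
    ∃ S : Finset ℤ, W = Submodule.span ℂ (fourier '' (S : Set ℤ)) := by
  have hfin : {n : ℤ | fourier n ∈ W}.Finite := by
    have hli : LinearIndependent ℂ (fun n : {n : ℤ | fourier n ∈ W} => (⟨fourier n, n.2⟩ : W)) :=
      .of_comp W.subtype (linearIndependent_fourier.comp _ Subtype.val_injective)
    exact hli.finite
  refine ⟨hfin.toFinset, le_antisymm (fun f hf => ?_) (Submodule.span_le.2 ?_)⟩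
  · have hzero : ∀ n ∉ hfin.toFinset, fourierCoeff f n = 0 := fun n hn => by
      contrapose! hn
      simpa using fourier_mem_of_fourierCoeff_ne_zero W hW hf hn
    have hsum := hasSum_fourier_series_of_summable
      (summable_of_ne_finset_zero (s := hfin.toFinset) hzero)
    rw [hsum.unique (hasSum_sum_of_ne_finset_zero fun n hn => by rw [hzero n hn, zero_smul])]
    exact Submodule.sum_mem _ fun n hn =>
      Submodule.smul_mem _ _ (Submodule.subset_span (Set.mem_image_of_mem _ hn))
  · rintro _ ⟨n, hn, rfl⟩
    simpa using hn

/-- Restriction along the covering map `ℝ → ℝ / Tℤ`. -/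
noncomputable def AddCircle.pullback (T : ℝ) : C(AddCircle T, ℂ) →ₗ[ℂ] (ℝ → ℂ) where
  toFun f t := f t
  map_add' _ _ := rfl
  map_smul' _ _ := rfl

theorem AddCircle.pullback_injective (T : ℝ) : Function.Injective (AddCircle.pullback T) := by
  intro f g h
  ext x
  induction x using QuotientAddGroup.induction_on with
  | H t => exact congrFun h t

theorem AddCircle.mem_range_pullback {T : ℝ} {f : ℝ → ℂ} (hf : Continuous f)
    (hper : Function.Periodic f T) : f ∈ LinearMap.range (AddCircle.pullback T) :=
  ⟨⟨hper.lift, continuous_quot_lift _ hf⟩, funext fun t => hper.lift_coe t⟩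

/-- **Proposition 1: finite-dimensional translation-invariant subspaces of continuous
periodic functions are spanned by complex exponentials.**  If `V` is a finite-dimensional
complex subspace of the continuous `1`-periodic functions `ℝ → ℂ` that is invariant under
all translations, then `V = span{e_{k_1}, …, e_{k_{N₀}}}` for distinct integers
`k_1, …, k_{N₀}` with `N₀ = dim V`, where `e_k(t) = exp(2πikt)`. -/
theorem translation_invariant_subspace_spanned_by_exponentials
    (V : Submodule ℂ (ℝ → ℂ))
    (hcont : ∀ f ∈ V, Continuous f)
    (hper : ∀ f ∈ V, ∀ t : ℝ, f (t + 1) = f t)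
    (hshift : ∀ f ∈ V, ∀ t₀ : ℝ, (fun t => f (t - t₀)) ∈ V)
    [FiniteDimensional ℂ V] :
    ∃ k : Fin (Module.finrank ℂ V) → ℤ, Function.Injective k ∧
      V = Submodule.span ℂ
        (Set.range fun n => fun t : ℝ =>
          Complex.exp (2 * Real.pi * Complex.I * (k n : ℂ) * (t : ℂ))) := by
  let W := V.comap (AddCircle.pullback 1)
  have hVW : W.map (AddCircle.pullback 1) = V := Submodule.map_comap_eq_of_le
    fun f hf => AddCircle.mem_range_pullback (hcont f hf) (hper f hf)
  let e : W ≃ₗ[ℂ] W.map (AddCircle.pullback 1) :=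
    Submodule.equivMapOfInjective _ (AddCircle.pullback_injective 1) W
  have : FiniteDimensional ℂ (W.map (AddCircle.pullback 1)) := by rw [hVW]; infer_instance
  have : FiniteDimensional ℂ W := e.symm.finiteDimensional
  obtain ⟨S, hS⟩ := exists_finset_eq_span_fourier W fun f hf a => by
    induction a using QuotientAddGroup.induction_on with
    | H a => exact hshift _ hf a
  have hcard : S.card = Module.finrank ℂ V := by
    rw [← hVW, ← e.finrank_eq, hS, Set.image_eq_range]
    simpa [Function.comp_def] using (finrank_span_eq_card
      (linearIndependent_fourier.comp _ (Subtype.val_injective (p := (· ∈ S))))).symm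
  refine ⟨S.orderEmbOfFin hcard, (S.orderEmbOfFin hcard).injective, ?_⟩
  conv_lhs => rw [← hVW, hS, Submodule.map_span, ← S.range_orderEmbOfFin hcard, ← Set.range_comp,
    ← Set.range_comp]
  congr 2
  ext n t
  simp [AddCircle.pullback]
end

section
/- Let V be a finite-dimensional complex subspace of the space of infinitely differentiable 1-periodic functions f : ℝ → ℂ that is invariant under all translations: for every f ∈ V and t₀ ∈ ℝ, the function t ↦ f(t − t₀) belongs to V. Then V is closed under differentiation: for every f ∈ V, the derivative f′ belongs to V. -/
/-- A finite-dimensional translation-invariant space of functions is closed under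
differentiation of its differentiable elements: it is closed for pointwise convergence, and the
derivative is the pointwise limit of difference quotients. -/
theorem Submodule.deriv_mem_of_translation_invariant
    (V : Submodule ℂ (ℝ → ℂ)) [FiniteDimensional ℂ V]
    (hshift : ∀ f ∈ V, ∀ t₀ : ℝ, (fun t => f (t - t₀)) ∈ V)
    {f : ℝ → ℂ} (hf : f ∈ V) (hdiff : Differentiable ℝ f) : deriv f ∈ V := by
  have hlim : Filter.Tendsto (fun (h : ℝ) (t : ℝ) => h⁻¹ • (f (t + h) - f t))
      (nhdsWithin 0 {0}ᶜ) (nhds (deriv f)) :=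
    tendsto_pi_nhds.2 fun t => hasDerivAt_iff_tendsto_slope_zero.1 (hdiff t).hasDerivAt
  refine V.closed_of_finiteDimensional.mem_of_tendsto hlim (Filter.Eventually.of_forall fun h => ?_)
  have hmem : (fun t => f (t + h)) ∈ V := by
    simpa only [sub_neg_eq_add] using hshift f hf (-h)
  exact V.smul_of_tower_mem h⁻¹ (V.sub_mem hmem hf)

/-- **Key step in the proof of Proposition 1.**  A finite-dimensional translation-invariant
complex subspace `V` of the infinitely differentiable `1`-periodic functions `ℝ → ℂ` is
closed under differentiation: `f ∈ V → f′ ∈ V`. -/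
theorem translation_invariant_subspace_closed_under_deriv
    (V : Submodule ℂ (ℝ → ℂ))
    (hsmooth : ∀ f ∈ V, ContDiff ℝ (⊤ : ℕ∞) f)
    (hper : ∀ f ∈ V, ∀ t : ℝ, f (t + 1) = f t)
    (hshift : ∀ f ∈ V, ∀ t₀ : ℝ, (fun t => f (t - t₀)) ∈ V)
    [FiniteDimensional ℂ V] :
    ∀ f ∈ V, deriv f ∈ V := by
  intro f hf
  exact V.deriv_mem_of_translation_invariant hshift hf
    ((hsmooth f hf).differentiable (by simp))
end

section
/- Let H and H₂ be real inner product spaces, L : H → H₂ and ν : H → ℝ^M linear maps with ker L ∩ ker ν = {0}, F : ℝ^M → ℝ a strictly convex function, and λ > 0. Then the function φ : H → ℝ defined by φ(f) = F(ν(f)) + λ‖Lf‖² is strictly convex: for all f ≠ g in H and μ ∈ (0,1), φ(μf + (1−μ)g) < μφ(f) + (1−μ)φ(g). -/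
/-- The defect in Jensen's inequality for the squared norm of an inner product space. -/
theorem norm_sq_convex_combination {E : Type*} [NormedAddCommGroup E] [InnerProductSpace ℝ E]
    (x y : E) (t : ℝ) :
    ‖t • x + (1 - t) • y‖ ^ 2 =
      t * ‖x‖ ^ 2 + (1 - t) * ‖y‖ ^ 2 - t * (1 - t) * ‖x - y‖ ^ 2 := by
  rw [norm_add_sq_real, norm_sub_sq_real, norm_smul, norm_smul, mul_pow, mul_pow,
    real_inner_smul_left, real_inner_smul_right, Real.norm_eq_abs, Real.norm_eq_abs, sq_abs, sq_abs]
  ring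


/-- **Strict-convexity part of Lemma 1 (Appendix D).**  If `L : H → H₂` and
`ν : H → ℝ^M` are linear with `ker L ∩ ker ν = {0}`, `F : ℝ^M → ℝ` is strictly convex and
`λ > 0`, then `φ(f) = F(ν(f)) + λ‖Lf‖²` is strictly convex. -/
theorem objective_strictly_convex
    {H H₂ : Type*} [NormedAddCommGroup H] [InnerProductSpace ℝ H]
    [NormedAddCommGroup H₂] [InnerProductSpace ℝ H₂]
    {M : ℕ} (L : H →ₗ[ℝ] H₂) (ν : H →ₗ[ℝ] (Fin M → ℝ))
    (hker : LinearMap.ker L ⊓ LinearMap.ker ν = ⊥)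
    (F : (Fin M → ℝ) → ℝ) (hF : StrictConvexOn ℝ Set.univ F)
    (lam : ℝ) (hlam : 0 < lam) :
    ∀ f g : H, f ≠ g → ∀ μ : ℝ, 0 < μ → μ < 1 →
      F (ν (μ • f + (1 - μ) • g)) + lam * ‖L (μ • f + (1 - μ) • g)‖ ^ 2 <
        μ * (F (ν f) + lam * ‖L f‖ ^ 2) + (1 - μ) * (F (ν g) + lam * ‖L g‖ ^ 2) := by
  intro f g hfg μ h0 h1
  have h1' : 0 < 1 - μ := sub_pos.2 h1
  simp only [map_add, map_smul, norm_sq_convex_combination]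
  by_cases hν : ν f = ν g
  · have hL : L f - L g ≠ 0 := fun h => hfg <| sub_eq_zero.1 <| by
      rw [← Submodule.mem_bot ℝ, ← hker]
      simp [h, hν]
    have hpos : 0 < lam * (μ * (1 - μ) * ‖L f - L g‖ ^ 2) := by positivity
    rw [hν, ← add_smul, add_sub_cancel, one_smul]
    linarith
  · have hlt := hF.2 (Set.mem_univ (ν f)) (Set.mem_univ (ν g)) hν h0 h1' (add_sub_cancel μ 1)
    have hnonneg : 0 ≤ lam * (μ * (1 - μ) * ‖L f - L g‖ ^ 2) := by positivity
    simp only [smul_eq_mul] at hlt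
    linarith
end
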